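/- arXiv:2002.10063 — 2 statements merged into one kernel-verified Lean document; each statement's English description precedes it below -/
import Mathlib

section
/- Let R be a ring, A its center, and 𝔪 ⊂ R a maximal left ideal. Suppose R is finitely generated as a module over A. Then 𝔫 := 𝔪 ∩ A is a maximal ideal of A. -/
/-- An element of `R` outside a maximal left ideal `𝔪`, and lying in the center of `R`, acts
surjectively on `R ⧸ 𝔪`. -/
theorem Ideal.IsMaximal.exists_center_smul_eq {R : Type*} [Ring R] {𝔪 : Ideal R}
    (h𝔪 : 𝔪.IsMaximal) {a : Subring.center R} (ha : (a : R) ∉ 𝔪) (y : R ⧸ 𝔪) :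
    ∃ z : R ⧸ 𝔪, a • z = y := by
  obtain ⟨y, rfl⟩ := Submodule.Quotient.mk_surjective 𝔪 y
  have one_mem : (1 : R) ∈ 𝔪 ⊔ Ideal.span {(a : R)} :=
    (Ideal.isMaximal_iff.mp h𝔪).2 _ _ le_sup_left ha
      (Ideal.mem_sup_right (Ideal.mem_span_singleton_self _))
  obtain ⟨m, hm, t, ht, hmt⟩ := Submodule.mem_sup.mp one_mem
  obtain ⟨s, rfl⟩ := Ideal.mem_span_singleton'.mp ht
  refine ⟨Submodule.Quotient.mk (y * s), ?_⟩
  rw [← Submodule.Quotient.mk_smul, eq_comm, Submodule.Quotient.eq]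
  have key : y - a • (y * s) = y * m := by
    rw [Subring.smul_def, smul_eq_mul, ← Subring.mem_center_iff.mp a.2, mul_assoc,
      eq_sub_of_add_eq hmt, mul_sub, mul_one]
  exact key ▸ 𝔪.mul_mem_left y hm

theorem stmt2 (R : Type*) [Ring R] [Algebra ℂ R]
    [Module.Finite (Subring.center R) R]
    (𝔪 : Ideal R) [𝔪.IsMaximal] :
    (𝔪.comap (Subring.center R).subtype).IsMaximal := by
  have h𝔪 : 𝔪.IsMaximal := inferInstance
  refine Ideal.isMaximal_iff.mpr
    ⟨fun h => (Ideal.isMaximal_iff.mp h𝔪).1 (by simpa using h), fun J a hJ ha haJ => ?_⟩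
  have top_le : (⊤ : Submodule (Subring.center R) (R ⧸ 𝔪)) ≤ Ideal.span {a} • ⊤ := by
    intro y _
    obtain ⟨z, rfl⟩ := h𝔪.exists_center_smul_eq ha y
    exact Submodule.smul_mem_smul (Ideal.mem_span_singleton_self a) trivial
  obtain ⟨r, hr, hr0⟩ := Submodule.exists_sub_one_mem_and_smul_eq_zero_of_fg_of_le_smul
    (Ideal.span {a}) ⊤ Module.Finite.fg_top top_le
  have r_mem : (r : R) ∈ 𝔪 := by
    have h := hr0 (Submodule.Quotient.mk 1) trivial
    rw [← Submodule.Quotient.mk_smul, Submodule.Quotient.mk_eq_zero] at h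
    simpa [Subring.smul_def] using h
  have sub_mem : r - 1 ∈ J := (Ideal.span_singleton_le_iff_mem J).mpr haJ hr
  simpa using J.sub_mem (hJ (show r ∈ 𝔪.comap (Subring.center R).subtype from r_mem)) sub_mem
end

section
/- Let A be a commutative Noetherian ring, M a finitely generated A-module, and f ∈ A. The canonical map M → M^∧_f (f-adic completion) restricts to an isomorphism from the f-torsion submodule M^f of M onto the f-torsion submodule (M^∧_f)^f of M^∧_f. -/
theorem mem_span_singleton_pow_smul_top_iff {A : Type*} [CommRing A] {M : Type*} [AddCommGroup M]
    [Module A M] (f : A) (n : ℕ) (x : M) :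
    x ∈ (Ideal.span {f} ^ n • ⊤ : Submodule A M) ↔ ∃ y : M, f ^ n • y = x := by
  rw [Ideal.span_singleton_pow, Submodule.ideal_span_singleton_smul,
    Submodule.mem_smul_pointwise_iff_exists]
  simp

/-- In a Noetherian module the `f`-power torsion meets `f ^ N • M` trivially for some `N`. -/
theorem exists_pow_smul_eq_zero_of_pow_smul_pow_smul_eq_zero {A : Type*} [CommRing A]
    {M : Type*} [AddCommGroup M] [Module A M] [IsNoetherian A M] (f : A) :
    ∃ N : ℕ, ∀ (k : ℕ) (x : M), f ^ k • f ^ N • x = 0 → f ^ N • x = 0 := by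
  have hmono : Monotone fun n : ℕ ↦ Submodule.torsionBy A M (f ^ n) := fun m n hmn ↦
    Submodule.torsionBy_le_torsionBy_of_dvd _ _ (pow_dvd_pow f hmn)
  obtain ⟨N, hN⟩ := monotone_stabilizes_iff_noetherian.mpr ‹IsNoetherian A M› ⟨_, hmono⟩
  refine ⟨N, fun k x hx ↦ ?_⟩
  have hmem : x ∈ Submodule.torsionBy A M (f ^ (k + N)) := by
    rwa [Submodule.mem_torsionBy_iff, pow_add, mul_smul]
  have heq : Submodule.torsionBy A M (f ^ N) = Submodule.torsionBy A M (f ^ (k + N)) :=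
    hN (k + N) (Nat.le_add_left N k)
  rwa [← heq, Submodule.mem_torsionBy_iff] at hmem

theorem AdicCompletion.mkQ_eq_eval_of_le {A : Type*} [CommRing A] {I : Ideal A}
    {M : Type*} [AddCommGroup M] [Module A M] {c : AdicCompletion I M} {n p : ℕ} (hnp : n ≤ p)
    {x : M} (hx : Submodule.mkQ (I ^ p • ⊤ : Submodule A M) x = AdicCompletion.eval I M p c) :
    Submodule.mkQ (I ^ n • ⊤ : Submodule A M) x = AdicCompletion.eval I M n c := by
  rw [AdicCompletion.eval_apply] at hx ⊢
  rw [← AdicCompletion.transitionMap_comp_eval_apply _ _ hnp c, ← hx]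
  rfl

/-- Every truncation of an `f ^ k`-torsion element of the completion lifts to an `f ^ k`-torsion
element of the module. -/
theorem AdicCompletion.exists_pow_smul_eq_zero_and_mkQ_eq_eval {A : Type*} [CommRing A]
    {M : Type*} [AddCommGroup M] [Module A M] {f : A} {k : ℕ}
    {c : AdicCompletion (Ideal.span {f}) M} (hc : f ^ k • c = 0) (n : ℕ) :
    ∃ t : M, f ^ k • t = 0 ∧
      Submodule.mkQ (Ideal.span {f} ^ n • ⊤ : Submodule A M) t =
        AdicCompletion.eval (Ideal.span {f}) M n c := by
  obtain ⟨m, hm⟩ := Submodule.mkQ_surjective _ (AdicCompletion.eval (Ideal.span {f}) M (n + k) c)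
  have hfm : f ^ k • m ∈ (Ideal.span {f} ^ (n + k) • ⊤ : Submodule A M) := by
    rw [← Submodule.ker_mkQ (Ideal.span {f} ^ (n + k) • ⊤ : Submodule A M), LinearMap.mem_ker,
      map_smul, hm, ← map_smul, hc, _root_.map_zero]
  obtain ⟨y, hy⟩ := (mem_span_singleton_pow_smul_top_iff f _ _).mp hfm
  refine ⟨m - f ^ n • y, ?_, ?_⟩
  · rw [smul_sub, ← hy, ← mul_smul, ← pow_add, add_comm k n, sub_self]
  · have hfy : Submodule.mkQ (Ideal.span {f} ^ n • ⊤ : Submodule A M) (f ^ n • y) = 0 := by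
      rw [← LinearMap.mem_ker, Submodule.ker_mkQ]
      exact (mem_span_singleton_pow_smul_top_iff f _ _).mpr ⟨y, rfl⟩
    rw [map_sub, hfy, sub_zero]
    exact mkQ_eq_eval_of_le (Nat.le_add_right n k) hm

theorem stmt5 (A : Type*) [CommRing A] [IsNoetherianRing A]
    (M : Type*) [AddCommGroup M] [Module A M] [Module.Finite A M] (f : A) :
    (∀ m₁ m₂ : M, (∃ k : ℕ, 1 ≤ k ∧ f ^ k • m₁ = 0) → (∃ k : ℕ, 1 ≤ k ∧ f ^ k • m₂ = 0) →
        AdicCompletion.of (Ideal.span {f}) M m₁ = AdicCompletion.of (Ideal.span {f}) M m₂ →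
        m₁ = m₂) ∧
    (∀ c : AdicCompletion (Ideal.span {f}) M, (∃ k : ℕ, 1 ≤ k ∧ f ^ k • c = 0) →
        ∃ m : M, (∃ k : ℕ, 1 ≤ k ∧ f ^ k • m = 0) ∧
          AdicCompletion.of (Ideal.span {f}) M m = c) := by
  obtain ⟨N, hN⟩ := exists_pow_smul_eq_zero_of_pow_smul_pow_smul_eq_zero (M := M) f
  have eq_of_mkQ_eq : ∀ (k : ℕ) (x y : M), f ^ k • x = 0 → f ^ k • y = 0 →
      Submodule.mkQ (Ideal.span {f} ^ N • ⊤ : Submodule A M) x = Submodule.mkQ _ y → x = y := by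
    intro k x y hx hy hxy
    rw [← sub_eq_zero, ← map_sub, ← LinearMap.mem_ker, Submodule.ker_mkQ,
      mem_span_singleton_pow_smul_top_iff] at hxy
    obtain ⟨z, hz⟩ := hxy
    rw [← sub_eq_zero, ← hz]
    exact hN k z (by rw [hz, smul_sub, hx, hy, sub_zero])
  constructor
  · rintro m₁ m₂ ⟨k₁, -, h₁⟩ ⟨k₂, -, h₂⟩ h
    refine eq_of_mkQ_eq (k₁ + k₂) m₁ m₂ ?_ ?_ ?_
    · rw [add_comm, pow_add, mul_smul, h₁, smul_zero]
    · rw [pow_add, mul_smul, h₂, smul_zero]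
    · rw [← AdicCompletion.eval_of, h, AdicCompletion.eval_of]
  · rintro c ⟨k, hk, hc⟩
    choose t ht htc using AdicCompletion.exists_pow_smul_eq_zero_and_mkQ_eq_eval hc
    refine ⟨t N, ⟨k, hk, ht N⟩, AdicCompletion.ext fun n ↦ ?_⟩
    have htN : t N = t (max n N) :=
      eq_of_mkQ_eq k _ _ (ht _) (ht _) ((htc N).trans
        (AdicCompletion.mkQ_eq_eval_of_le (le_max_right n N) (htc _)).symm)
    rw [AdicCompletion.of_apply, htN,
      AdicCompletion.mkQ_eq_eval_of_le (le_max_left n N) (htc _), AdicCompletion.eval_apply]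
end
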